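/- Let 𝒫 be a finite nonempty set of N×N real row-stochastic matrices, each irreducible with strictly positive diagonal entries, and let (W_i)_{i≥1} be any sequence of elements of 𝒫 with left products W^{(t)} = W_t W_{t−1} ⋯ W_1. Then the rows of W^{(t)} become asymptotically identical: for every ε > 0 there exists T such that for all t ≥ T, max_j max_{i₁,i₂} |W^{(t)}_{i₁ j} − W^{(t)}_{i₂ j}| ≤ ε. -/

import Mathlib

open Matrix BigOperators

/-- A square real matrix is row-stochastic if all entries are nonnegative and
every row sums to `1`. -/
def RowStochastic {N : ℕ} (A : Matrix (Fin N) (Fin N) ℝ) : Prop :=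
  (∀ i j, 0 ≤ A i j) ∧ ∀ i, ∑ j, A i j = 1

/-- A (nonnegative) square matrix is irreducible if for every pair of indices
`i, j` some power `n ≥ 1` of the matrix has a strictly positive `(i,j)` entry. -/
def IrredMat {N : ℕ} (A : Matrix (Fin N) (Fin N) ℝ) : Prop :=
  ∀ i j, ∃ n : ℕ, 1 ≤ n ∧ 0 < (A ^ n) i j

/-- The MDT operator of length `t` for the sequence `W₁, W₂, …`: the left product
`W^{(t)} = W t * W (t-1) * ⋯ * W 1` (with `W^{(0)} = 1`). -/
def MDTprod {N : ℕ} (W : ℕ → Matrix (Fin N) (Fin N) ℝ) : ℕ → Matrix (Fin N) (Fin N) ℝ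
  | 0 => 1
  | t + 1 => W (t + 1) * MDTprod W t

namespace RowStochastic

variable {N : ℕ} {A B : Matrix (Fin N) (Fin N) ℝ}

theorem one : RowStochastic (1 : Matrix (Fin N) (Fin N) ℝ) := by
  refine ⟨fun i j => ?_, fun i => by simp [Matrix.one_apply]⟩
  rw [Matrix.one_apply]
  split_ifs <;> norm_num

theorem mul (hA : RowStochastic A) (hB : RowStochastic B) : RowStochastic (A * B) := by
  refine ⟨fun i j => ?_, fun i => ?_⟩
  · rw [Matrix.mul_apply]
    exact Finset.sum_nonneg fun k _ => mul_nonneg (hA.1 i k) (hB.1 k j)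
  · simp only [Matrix.mul_apply]
    rw [Finset.sum_comm]
    simp only [← Finset.mul_sum, hB.2, mul_one, hA.2]

/-- If all entries of the row-stochastic matrix `A` are at least `c`, then multiplication by `A`
contracts the oscillation of a vector by the factor `1 - c`. -/
theorem mulVec_sub_mulVec_le (hA : RowStochastic A) {c D : ℝ} (hc1 : c ≤ 1)
    (hc : ∀ i j, c ≤ A i j) {x : Fin N → ℝ} (hx : ∀ i j, x i - x j ≤ D) (i j : Fin N) :
    (A *ᵥ x) i - (A *ᵥ x) j ≤ (1 - c) * D := by
  have : Nonempty (Fin N) := ⟨i⟩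
  obtain ⟨p, hp⟩ := Finite.exists_max x
  obtain ⟨q, hq⟩ := Finite.exists_min x
  have upper : (A *ᵥ x) i ≤ x p - c * (x p - x q) := by
    have h₁ : x p - (A *ᵥ x) i = ∑ l, A i l * (x p - x l) := by
      simp only [mul_sub, Finset.sum_sub_distrib, ← Finset.sum_mul, hA.2, one_mul,
        Matrix.mulVec, dotProduct]
    have h₂ : A i q * (x p - x q) ≤ ∑ l, A i l * (x p - x l) :=
      Finset.single_le_sum (f := fun l => A i l * (x p - x l))
        (fun l _ => mul_nonneg (hA.1 i l) (sub_nonneg.2 (hp l))) (Finset.mem_univ q)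
    have h₃ := mul_le_mul_of_nonneg_right (hc i q) (sub_nonneg.2 (hp q))
    linarith
  have lower : x q ≤ (A *ᵥ x) j := by
    have h₁ : (A *ᵥ x) j - x q = ∑ l, A j l * (x l - x q) := by
      simp only [mul_sub, Finset.sum_sub_distrib, ← Finset.sum_mul, hA.2, one_mul,
        Matrix.mulVec, dotProduct]
    have h₂ : 0 ≤ ∑ l, A j l * (x l - x q) :=
      Finset.sum_nonneg fun l _ => mul_nonneg (hA.1 j l) (sub_nonneg.2 (hq l))
    linarith
  have := mul_le_mul_of_nonneg_left (hx p q) (sub_nonneg.2 hc1)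
  linarith

theorem MDTprod {W : ℕ → Matrix (Fin N) (Fin N) ℝ} (hW : ∀ i, 1 ≤ i → RowStochastic (W i)) :
    ∀ t, RowStochastic (MDTprod W t)
  | 0 => one
  | t + 1 => (hW (t + 1) (Nat.le_add_left 1 t)).mul (RowStochastic.MDTprod hW t)

end RowStochastic

/-- An irreducible matrix has a nonzero entry leading from the complement of a nonempty proper set
of indices into that set. -/
theorem IrredMat.exists_ne_zero {N : ℕ} {A : Matrix (Fin N) (Fin N) ℝ} (hA : IrredMat A)
    {S : Set (Fin N)} {i j : Fin N} (hi : i ∉ S) (hj : j ∈ S) :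
    ∃ k ∉ S, ∃ l ∈ S, A k l ≠ 0 := by
  by_contra! h
  have key : ∀ n : ℕ, ∀ k ∉ S, ∀ l ∈ S, (A ^ n) k l = 0 := by
    intro n
    induction n with
    | zero =>
      intro k hk l hl
      rw [pow_zero, Matrix.one_apply_ne]
      rintro rfl
      exact hk hl
    | succ n ih =>
      intro k hk l hl
      rw [pow_succ, Matrix.mul_apply]
      refine Finset.sum_eq_zero fun m _ => ?_
      by_cases hm : m ∈ S
      · rw [ih k hk m hm, zero_mul]
      · rw [h m hm l hl, mul_zero]
  obtain ⟨n, -, hn⟩ := hA i j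
  exact hn.ne' (key n i hi j hj)

/-- The positive entries of finitely many matrices are bounded below by a positive constant. -/
theorem exists_pos_le_of_entry_pos {N : ℕ} (P : Finset (Matrix (Fin N) (Fin N) ℝ)) :
    ∃ δ : ℝ, 0 < δ ∧ δ ≤ 1 ∧ ∀ A ∈ P, ∀ i j, 0 < A i j → δ ≤ A i j := by
  classical
  let s : Finset ℝ := insert 1 (((P ×ˢ Finset.univ ×ˢ Finset.univ).image
    fun p : Matrix (Fin N) (Fin N) ℝ × Fin N × Fin N => p.1 p.2.1 p.2.2).filter (0 < ·))
  have hs : s.Nonempty := Finset.insert_nonempty _ _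
  refine ⟨s.min' hs, ?_, s.min'_le 1 (Finset.mem_insert_self _ _), fun A hA i j hij => ?_⟩
  · rcases Finset.mem_insert.1 (s.min'_mem hs) with h | h
    · rw [h]
      exact one_pos
    · exact (Finset.mem_filter.1 h).2
  · refine s.min'_le _ (Finset.mem_insert_of_mem (Finset.mem_filter.2 ⟨?_, hij⟩))
    exact Finset.mem_image.2 ⟨(A, i, j), by simp [hA], rfl⟩

theorem MDTprod_add {N : ℕ} (W : ℕ → Matrix (Fin N) (Fin N) ℝ) (s : ℕ) :
    ∀ k, MDTprod W (s + k) = MDTprod (fun i => W (s + i)) k * MDTprod W s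
  | 0 => (one_mul _).symm
  | k + 1 => by
    change W (s + (k + 1)) * MDTprod W (s + k) = W (s + (k + 1)) * MDTprod _ k * MDTprod W s
    rw [MDTprod_add W s k, mul_assoc]

/-- After `k` steps, each column of the product has at least `min (k + 1) N` entries which are
bounded below by `δ ^ k`. -/
theorem min_le_card_pow_le_MDTprod {N : ℕ} {W : ℕ → Matrix (Fin N) (Fin N) ℝ} {δ : ℝ}
    (hδ : 0 < δ) (hstoch : ∀ i, 1 ≤ i → RowStochastic (W i))
    (hdiag : ∀ i, 1 ≤ i → ∀ j, 0 < W i j j) (hirr : ∀ i, 1 ≤ i → IrredMat (W i))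
    (hle : ∀ i, 1 ≤ i → ∀ k l, 0 < W i k l → δ ≤ W i k l) (j : Fin N) (k : ℕ) :
    min (k + 1) N ≤ (Finset.univ.filter fun i => δ ^ k ≤ MDTprod W k i j).card := by
  induction k with
  | zero =>
    refine (min_le_left _ _).trans (Finset.card_pos.2 ⟨j, ?_⟩)
    simp [MDTprod]
  | succ k ih =>
    set S := Finset.univ.filter fun i => δ ^ k ≤ MDTprod W k i j
    set S' := Finset.univ.filter fun i => δ ^ (k + 1) ≤ MDTprod W (k + 1) i j
    have hk : 1 ≤ k + 1 := Nat.le_add_left 1 k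
    have step : ∀ i, ∀ l ∈ S, 0 < W (k + 1) i l → i ∈ S' := by
      intro i l hl hil
      refine Finset.mem_filter.2 ⟨Finset.mem_univ i, ?_⟩
      calc δ ^ (k + 1) = δ * δ ^ k := pow_succ' δ k
        _ ≤ W (k + 1) i l * MDTprod W k l j :=
          mul_le_mul (hle _ hk i l hil) (Finset.mem_filter.1 hl).2 (pow_pos hδ k).le hil.le
        _ ≤ ∑ m, W (k + 1) i m * MDTprod W k m j :=
          Finset.single_le_sum (f := fun m => W (k + 1) i m * MDTprod W k m j)
            (fun m _ => mul_nonneg ((hstoch _ hk).1 i m)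
              ((RowStochastic.MDTprod hstoch k).1 m j)) (Finset.mem_univ l)
    have hsub : S ⊆ S' := fun i hi => step i i hi (hdiag _ hk i)
    by_cases huniv : S = Finset.univ
    · have := Finset.card_le_card hsub
      rw [huniv, Finset.card_univ, Fintype.card_fin] at this
      exact (min_le_right _ _).trans this
    · obtain ⟨a, ha⟩ : ∃ a, a ∉ S := by
        by_contra! h
        exact huniv (Finset.eq_univ_iff_forall.2 h)
      have hN : 0 < N := j.pos
      obtain ⟨b, hb⟩ : S.Nonempty := Finset.card_pos.1 (by omega)
      obtain ⟨i, hi, l, hl, hil⟩ := (hirr _ hk).exists_ne_zero (S := (S : Set (Fin N)))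
        (by simpa only [Finset.mem_coe] using ha) (Finset.mem_coe.2 hb)
      have hpos : 0 < W (k + 1) i l := lt_of_le_of_ne ((hstoch _ hk).1 i l) hil.symm
      have : S ⊂ S' := Finset.ssubset_iff_of_subset hsub |>.2
        ⟨i, step i l (Finset.mem_coe.1 hl) hpos, fun h => hi (Finset.mem_coe.2 h)⟩
      have := Finset.card_lt_card this
      omega

theorem pow_le_MDTprod {N : ℕ} {W : ℕ → Matrix (Fin N) (Fin N) ℝ} {δ : ℝ}
    (hδ : 0 < δ) (hstoch : ∀ i, 1 ≤ i → RowStochastic (W i))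
    (hdiag : ∀ i, 1 ≤ i → ∀ j, 0 < W i j j) (hirr : ∀ i, 1 ≤ i → IrredMat (W i))
    (hle : ∀ i, 1 ≤ i → ∀ k l, 0 < W i k l → δ ≤ W i k l) (i j : Fin N) :
    δ ^ N ≤ MDTprod W N i j := by
  have hcard := min_le_card_pow_le_MDTprod hδ hstoch hdiag hirr hle j N
  rw [min_eq_right (Nat.le_succ N)] at hcard
  have huniv := Finset.eq_univ_of_card _
    (le_antisymm (Finset.card_le_univ _) ((Fintype.card_fin N).le.trans hcard))
  exact Finset.filter_eq_self.1 huniv i (Finset.mem_univ i)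

/-- **Weak ergodicity of MDTs (Wolfowitz).** For any sequence drawn from a finite
nonempty set of row-stochastic, irreducible matrices with strictly positive diagonal
entries, the rows of the left products `W^{(t)} = W_t ⋯ W_1` become asymptotically
identical: for every `ε > 0` there is `T` such that for all `t ≥ T` and all indices,
`|W^{(t)}_{i₁ j} − W^{(t)}_{i₂ j}| ≤ ε`. -/
theorem MDT_rows_asymptotically_identical {N : ℕ}
    (Pset : Finset (Matrix (Fin N) (Fin N) ℝ)) (hne : Pset.Nonempty)
    (hPset : ∀ A ∈ Pset, RowStochastic A ∧ (∀ i, 0 < A i i) ∧ IrredMat A)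
    (W : ℕ → Matrix (Fin N) (Fin N) ℝ)
    (hW : ∀ i, 1 ≤ i → W i ∈ Pset) :
    ∀ ε : ℝ, 0 < ε → ∃ T : ℕ, ∀ t, T ≤ t → ∀ (j i₁ i₂ : Fin N),
      |MDTprod W t i₁ j - MDTprod W t i₂ j| ≤ ε := by
  obtain ⟨δ, hδ0, hδ1, hδ⟩ := exists_pos_le_of_entry_pos Pset
  have hstoch : ∀ i, 1 ≤ i → RowStochastic (W i) := fun i hi => (hPset _ (hW i hi)).1
  have hshift : ∀ s i : ℕ, 1 ≤ i → 1 ≤ s + i := fun s i hi => hi.trans (Nat.le_add_left i s)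
  have hc0 : 0 < δ ^ N := pow_pos hδ0 N
  have hc1 : δ ^ N ≤ 1 := pow_le_one₀ hδ0.le hδ1
  have decay : ∀ k : ℕ, ∀ j i₁ i₂,
      MDTprod W (k * N) i₁ j - MDTprod W (k * N) i₂ j ≤ (1 - δ ^ N) ^ k := by
    intro k
    induction k with
    | zero =>
      intro j i₁ i₂
      rw [Nat.zero_mul, pow_zero]
      simp only [MDTprod, Matrix.one_apply]
      split_ifs <;> norm_num
    | succ k ih =>
      intro j i₁ i₂
      rw [Nat.succ_mul, MDTprod_add, pow_succ']
      have hN := RowStochastic.MDTprod (fun i hi => hstoch _ (hshift (k * N) i hi)) N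
      exact hN.mulVec_sub_mulVec_le hc1
        (pow_le_MDTprod hδ0 (fun i hi => hstoch _ (hshift _ i hi))
          (fun i hi => (hPset _ (hW _ (hshift _ i hi))).2.1)
          (fun i hi => (hPset _ (hW _ (hshift _ i hi))).2.2)
          fun i hi => hδ _ (hW _ (hshift _ i hi)))
        (ih j) i₁ i₂
  intro ε hε
  obtain ⟨k, hk⟩ := exists_pow_lt_of_lt_one hε (sub_lt_self 1 hc0)
  refine ⟨k * N, fun t ht j => ?_⟩
  obtain ⟨r, rfl⟩ := Nat.exists_eq_add_of_le ht
  have bound : ∀ i₁ i₂, MDTprod W (k * N + r) i₁ j - MDTprod W (k * N + r) i₂ j ≤ ε := by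
    intro i₁ i₂
    have hr := RowStochastic.MDTprod (fun i hi => hstoch _ (hshift (k * N) i hi)) r
    have := hr.mulVec_sub_mulVec_le zero_le_one hr.1 (decay k j) i₁ i₂
    rw [sub_zero, one_mul] at this
    rw [MDTprod_add]
    exact this.trans hk.le
  intro i₁ i₂
  exact abs_sub_le_iff.2 ⟨bound i₁ i₂, bound i₂ i₁⟩
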